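/- There is a universal constant C such that for every metric space (X,d) there exists an online algorithm A — a function from finite sequences of pairs of points of X to finite sets of unordered pairs of points of X, with A(s) ⊆ A(s') whenever s is a prefix of s' — such that for every sequence of pairs (s_1,t_1),…,(s_k,t_k) with k ≥ 1, writing H = A((s_1,t_1),…,(s_k,t_k)): (i) d_H(s_i, t_i) ≤ C·(1 + log₂ k)·d(s_i, t_i) for every i ∈ {1,…,k}; (ii) d(H) ≤ C·(1 + log₂ k)·SF, where SF is the minimum of d(F) over finite sets F of unordered pairs of points of X such that d_F(s_i, t_i) < ∞ for every i (i.e., F is a Steiner forest connecting all the pairs); and (iii) the number of edges of H is at most C·k. -/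

import Mathlib

open scoped Classical ENNReal

noncomputable section

variable {X : Type*} [MetricSpace X]

/-- The length of an unordered pair of points: the distance between its endpoints. -/
def edgeLen (e : Sym2 X) : ℝ :=
  Sym2.lift ⟨fun x y => dist x y, fun x y => dist_comm x y⟩ e

/-- The edges of a finite sequence of points: unordered pairs of consecutive points. -/
def edgeList (p : List X) : List (Sym2 X) :=
  (p.zip p.tail).map fun ab => s(ab.1, ab.2)

/-- The cost of a weighted graph (a finite set of unordered pairs of points):
the sum of the lengths of its edges. -/
def graphCost (H : Finset (Sym2 X)) : ℝ :=
  ∑ e ∈ H, edgeLen e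

/-- The total length of a finite sequence of points. -/
def pathLen (p : List X) : ℝ :=
  ((edgeList p).map edgeLen).sum

/-- `p` is a walk from `a` to `b` all of whose edges lie in `H`. -/
def IsWalkIn (H : Set (Sym2 X)) (a b : X) (p : List X) : Prop :=
  p.head? = some a ∧ p.getLast? = some b ∧ ∀ e ∈ edgeList p, e ∈ H

/-- The graph distance between `a` and `b` in the graph `H`: the infimum of the
lengths of walks from `a` to `b` using only edges of `H` (`∞` if there is none). -/
def graphDist (H : Set (Sym2 X)) (a b : X) : ℝ≥0∞ :=
  ⨅ p : { p : List X // IsWalkIn H a b p }, ENNReal.ofReal (pathLen p.1)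

/-- `Linked E w L a b`: some walk from `a` to `b` along edges of `E` has total weight at most `L`. -/
inductive Linked {V : Type*} (E : Set (Sym2 V)) (w : Sym2 V → ℝ) : ℝ → V → V → Prop
  | refl {L : ℝ} (a : V) (h : 0 ≤ L) : Linked E w L a a
  | step {L L' : ℝ} {a b c : V} (he : s(a, b) ∈ E) (h : Linked E w L b c)
      (hL : w s(a, b) + L ≤ L') : Linked E w L' a c

namespace Linked

variable {V : Type*} {E E' : Set (Sym2 V)} {w : Sym2 V → ℝ} {L L' : ℝ} {a b c : V}

theorem mono_len (h : Linked E w L a b) (hL : L ≤ L') : Linked E w L' a b := by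
  cases h with
  | refl _ h => exact .refl _ (h.trans hL)
  | step he h h' => exact .step he h (h'.trans hL)

theorem mono_set (h : Linked E w L a b) (hE : E ⊆ E') : Linked E' w L a b := by
  induction h with
  | refl _ h => exact .refl _ h
  | step he _ h' ih => exact .step (hE he) ih h'

theorem trans (h : Linked E w L a b) (h' : Linked E w L' b c) : Linked E w (L + L') a c := by
  induction h with
  | refl _ h => exact h'.mono_len (by linarith)
  | step he _ hL ih => exact .step he (ih h') (by linarith)

theorem single (he : s(a, b) ∈ E) : Linked E w (w s(a, b)) a b :=
  .step he (.refl b le_rfl) (by simp)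

theorem symm (h : Linked E w L a b) : Linked E w L b a := by
  induction h with
  | refl _ h => exact .refl _ h
  | @step L L' a b c he _ hL ih =>
    rw [Sym2.eq_swap] at he hL
    exact (ih.trans (single he)).mono_len (by linarith)

theorem nonneg (hw : ∀ e, 0 ≤ w e) (h : Linked E w L a b) : 0 ≤ L := by
  induction h with
  | refl _ h => exact h
  | @step L L' a b c he _ hL ih => linarith [hw s(a, b)]

theorem of_weight_le {w' : Sym2 V → ℝ} {M : ℝ} (hM : 0 ≤ M) (hw : ∀ e ∈ E, w' e ≤ M * w e)
    (h : Linked E w L a b) : Linked E w' (M * L) a b := by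
  induction h with
  | refl _ h => exact .refl _ (mul_nonneg hM h)
  | @step L L' a b c he _ hL ih =>
    refine .step he ih ?_
    have := mul_le_mul_of_nonneg_left hL hM
    linarith [hw _ he]

/-- A walk in `E` with one additional edge uses that edge at most once, without loss of
generality. -/
theorem insert_split {u v : V} (hw : ∀ e, 0 ≤ w e) (h : Linked (insert s(u, v) E) w L a b) :
    Linked E w L a b ∨
      (∃ i j, i + w s(u, v) + j ≤ L ∧ Linked E w i a u ∧ Linked E w j v b) ∨
      (∃ i j, i + w s(u, v) + j ≤ L ∧ Linked E w i a v ∧ Linked E w j u b) := by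
  induction h with
  | refl _ h => exact .inl (.refl _ h)
  | @step L L' a c b he _ hL ih =>
    have h0 := hw s(u, v)
    rcases he with he | he
    · rw [he] at hL
      rcases Sym2.eq_iff.1 he with ⟨rfl, rfl⟩ | ⟨rfl, rfl⟩
      · rcases ih with h | ⟨i, j, hij, h, h'⟩ | ⟨i, j, hij, h, h'⟩
        · exact .inr (.inl ⟨0, L, by linarith, .refl _ le_rfl, h⟩)
        · exact .inr (.inl ⟨0, j, by linarith [h.nonneg hw], .refl _ le_rfl, h'⟩)
        · exact .inl (h'.mono_len (by linarith [h.nonneg hw]))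
      · rcases ih with h | ⟨i, j, hij, h, h'⟩ | ⟨i, j, hij, h, h'⟩
        · exact .inr (.inr ⟨0, L, by linarith, .refl _ le_rfl, h⟩)
        · exact .inl (h'.mono_len (by linarith [h.nonneg hw]))
        · exact .inr (.inr ⟨0, j, by linarith [h.nonneg hw], .refl _ le_rfl, h'⟩)
    · rcases ih with h | ⟨i, j, hij, h, h'⟩ | ⟨i, j, hij, h, h'⟩
      · exact .inl (.step he h hL)
      · exact .inr (.inl ⟨w s(a, c) + i, j, by linarith, .step he h le_rfl, h'⟩)
      · exact .inr (.inr ⟨w s(a, c) + i, j, by linarith, .step he h le_rfl, h'⟩)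

end Linked

/-- The unit weight, for which `Linked` counts hops. -/
def hopWeight (V : Type*) : Sym2 V → ℝ := fun _ => 1

/-- No edge of `E` can be bypassed by at most `T` other edges of `E`. -/
def LargeGirth {V : Type*} (E : Set (Sym2 V)) (T : ℝ) : Prop :=
  ∀ a b, s(a, b) ∈ E → ¬ Linked (E \ {s(a, b)}) (hopWeight V) T a b

section Girth

variable {V : Type*}

theorem hopWeight_nonneg (e : Sym2 V) : 0 ≤ hopWeight V e := zero_le_one

theorem LargeGirth.mono {E E' : Set (Sym2 V)} {T : ℝ} (h : LargeGirth E T) (hE : E' ⊆ E) :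
    LargeGirth E' T := fun a b hab hl =>
  h a b (hE hab) (hl.mono_set (Set.sdiff_subset_sdiff_left hE))

theorem LargeGirth.insert {E : Set (Sym2 V)} {T : ℝ} {u v : V} (h : LargeGirth E T)
    (huv : ¬ Linked E (hopWeight V) T u v) : LargeGirth (insert s(u, v) E) T := by
  intro a b hab hl
  by_cases heq : s(a, b) = s(u, v)
  · have hl' : Linked E (hopWeight V) T a b := by
      refine hl.mono_set ?_
      rw [heq]
      rintro e ⟨he | he, hne⟩
      · exact absurd he hne
      · exact he
    rcases Sym2.eq_iff.1 heq with ⟨rfl, rfl⟩ | ⟨rfl, rfl⟩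
    · exact huv hl'
    · exact huv hl'.symm
  · have habE : s(a, b) ∈ E := by
      rcases hab with hab | hab
      · exact absurd hab heq
      · exact hab
    have hl' : Linked (Insert.insert s(u, v) (E \ {s(a, b)})) (hopWeight V) T a b := by
      refine hl.mono_set ?_
      rintro e ⟨he | he, hne⟩
      · exact .inl he
      · exact .inr ⟨he, hne⟩
    have hsub : E \ {s(a, b)} ⊆ E := Set.sdiff_subset
    rcases hl'.insert_split hopWeight_nonneg with hl' | ⟨i, j, hij, h₁, h₂⟩ | ⟨i, j, hij, h₁, h₂⟩
    · exact h a b habE hl'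
    · refine huv ((((h₁.mono_set hsub).symm.trans (.single habE)).trans
        (h₂.mono_set hsub).symm).mono_len ?_)
      simpa [hopWeight] using hij
    · refine huv ((((h₂.mono_set hsub).trans (.single (Sym2.eq_swap ▸ habE))).trans
        (h₁.mono_set hsub)).mono_len ?_)
      simp only [hopWeight] at hij ⊢
      linarith

/-- The vertices of `W` that are at most `r` hops away from `v`. -/
def hopBall (E : Finset (Sym2 V)) (W : Finset V) (v : V) : ℕ → Finset V
  | 0 => {v}
  | r + 1 => hopBall E W v r ∪ W.filter fun y => ∃ x ∈ hopBall E W v r, s(x, y) ∈ E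

/-- A breadth-first search tree spans each ball. -/
theorem exists_tree_hopBall (E : Finset (Sym2 V)) (W : Finset V) (v : V) (r : ℕ) :
    ∃ P ⊆ E, P.card ≤ (hopBall E W v r).card ∧
      ∀ x ∈ hopBall E W v r, Linked (P : Set (Sym2 V)) (hopWeight V) r v x := by
  induction r with
  | zero =>
    refine ⟨∅, by simp, by simp, fun x hx => ?_⟩
    simp only [hopBall, Finset.mem_singleton] at hx
    exact hx ▸ .refl _ (by simp)
  | succ r ih =>
    obtain ⟨P, hPE, hcard, hP⟩ := ih
    set B := hopBall E W v r with hB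
    set D := (W.filter fun y => ∃ x ∈ B, s(x, y) ∈ E) \ B with hD
    have hpar : ∀ y ∈ D, ∃ x ∈ B, s(x, y) ∈ E := fun y hy =>
      (Finset.mem_filter.1 (Finset.mem_sdiff.1 hy).1).2
    choose! f hfB hfE using hpar
    have hball : hopBall E W v (r + 1) = B ∪ D := by
      simp [hopBall, hD, ← hB]
    refine ⟨P ∪ D.image fun y => s(f y, y), ?_, ?_, ?_⟩
    · refine Finset.union_subset hPE fun e he => ?_
      obtain ⟨y, hy, rfl⟩ := Finset.mem_image.1 he
      exact hfE y hy
    · rw [hball, Finset.card_union_of_disjoint Finset.disjoint_sdiff]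
      exact (Finset.card_union_le _ _).trans (add_le_add hcard Finset.card_image_le)
    · intro x hx
      rw [hball] at hx
      rcases Finset.mem_union.1 hx with hx | hx
      · refine ((hP x hx).mono_set ?_).mono_len (by simp)
        simp
      · have h₁ := (hP _ (hfB x hx)).mono_set
          (E' := ↑(P ∪ D.image fun y => s(f y, y))) (by simp)
        have h₂ : s(f x, x) ∈ (↑(P ∪ D.image fun y => s(f y, y)) : Set (Sym2 V)) :=
          Finset.mem_coe.2 (Finset.mem_union_right _ (Finset.mem_image_of_mem _ hx))
        exact (h₁.trans (.single h₂)).mono_len (by simp [hopWeight])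

theorem hopBall_subset {E : Finset (Sym2 V)} {W : Finset V} {v : V} (hv : v ∈ W) (r : ℕ) :
    hopBall E W v r ⊆ W := by
  induction r with
  | zero => simpa [hopBall] using hv
  | succ r ih => exact Finset.union_subset ih (Finset.filter_subset _ _)

theorem exists_card_hopBall_succ_le {E : Finset (Sym2 V)} {W : Finset V} {v : V} (hv : v ∈ W)
    {R : ℕ} (hR : W.card < 2 ^ R) :
    ∃ r < R, (hopBall E W v (r + 1)).card ≤ 2 * (hopBall E W v r).card := by
  by_contra! hcon
  have key : ∀ r ≤ R, 2 ^ r ≤ (hopBall E W v r).card := by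
    intro r hr
    induction r with
    | zero => simp [hopBall]
    | succ r ih =>
      have h₁ := ih (by omega)
      have h₂ := hcon r (by omega)
      rw [pow_succ]
      omega
  have := (key R le_rfl).trans (Finset.card_le_card (hopBall_subset hv R))
  omega

/-- A graph with fewer than `2 ^ R` vertices and girth above `2 * R` has linearly many edges. -/
theorem LargeGirth.card_le {R : ℕ} {W : Finset V} {E : Finset (Sym2 V)} (hR : W.card < 2 ^ R)
    (hE : ∀ e ∈ E, ∀ x ∈ e, x ∈ W) (h : LargeGirth (E : Set (Sym2 V)) (2 * R)) :
    E.card ≤ 2 * W.card := by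
  induction hn : W.card using Nat.strong_induction_on generalizing W E with
  | _ n ih =>
  subst hn
  rcases W.eq_empty_or_nonempty with rfl | ⟨v, hv⟩
  · have : E = ∅ := Finset.eq_empty_of_forall_notMem fun e he => by
      induction e with
      | _ a b => simpa using hE _ he a (Sym2.mem_mk_left a b)
    simp [this]
  obtain ⟨r, hr, hgrow⟩ := exists_card_hopBall_succ_le (E := E) hv hR
  obtain ⟨P, hPE, hPcard, hP⟩ := exists_tree_hopBall E W v (r + 1)
  set B := hopBall E W v r with hB
  have hBW : B ⊆ W := hopBall_subset hv r
  have hvB : v ∈ B := by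
    clear_value B
    subst hB
    clear * -
    induction r with
    | zero => simp [hopBall]
    | succ r ih => exact Finset.mem_union_left _ ih
  have hnear : ∀ a b, s(a, b) ∈ E → a ∈ B → s(a, b) ∈ P := by
    intro a b hab ha
    by_contra hnP
    have hb' : b ∈ hopBall E W v (r + 1) := Finset.mem_union_right _
      (Finset.mem_filter.2 ⟨hE _ hab b (Sym2.mem_mk_right a b), a, ha, hab⟩)
    have ha' : a ∈ hopBall E W v (r + 1) := Finset.mem_union_left _ ha
    refine h a b hab ((((hP a ha').symm.trans (hP b hb')).mono_len ?_).mono_set ?_)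
    · have : ((r + 1 : ℕ) : ℝ) ≤ R := by exact_mod_cast hr
      linarith
    · intro e he
      exact ⟨hPE he, fun heq => hnP (heq ▸ he)⟩
  have hsub : E ⊆ P ∪ E.filter (fun e => ∀ x ∈ e, x ∈ W \ B) := by
    intro e he
    by_cases hex : ∃ x ∈ e, x ∈ B
    · obtain ⟨x, ⟨y, rfl⟩, hx⟩ := hex
      exact Finset.mem_union_left _ (hnear x y he hx)
    · push Not at hex
      exact Finset.mem_union_right _ (Finset.mem_filter.2
        ⟨he, fun x hx => Finset.mem_sdiff.2 ⟨hE e he x hx, hex x hx⟩⟩)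
  have hcardWB : (W \ B).card + B.card = W.card := Finset.card_sdiff_add_card_eq_card hBW
  have hBpos : 0 < B.card := Finset.card_pos.2 ⟨v, hvB⟩
  have hrec := ih (W \ B).card (by omega) (W := W \ B)
    (E := E.filter (fun e => ∀ x ∈ e, x ∈ W \ B)) (by omega)
    (fun e he => (Finset.mem_filter.1 he).2)
    (h.mono (Finset.coe_subset.2 (Finset.filter_subset _ _))) rfl
  have := (Finset.card_le_card hsub).trans (Finset.card_union_le _ _)
  omega

end Girth

section Net

/-- The unordered pairs recorded by a family of parent pointers between net points. -/
def parentEdges {V : Type*} (P : Finset ((ℤ × V) × V)) : Finset (Sym2 V) :=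
  P.image fun q => s(q.1.2, q.2)

theorem parentEdges_mono {V : Type*} {P P' : Finset ((ℤ × V) × V)} (h : P ⊆ P') :
    parentEdges P ⊆ parentEdges P' :=
  Finset.image_subset_image h

theorem mem_parentEdges {V : Type*} {P : Finset ((ℤ × V) × V)} {i : ℤ} {x y : V}
    (h : ((i, x), y) ∈ P) : s(x, y) ∈ (parentEdges P : Set (Sym2 V)) :=
  Finset.mem_coe.2 (Finset.mem_image_of_mem (fun q : (ℤ × V) × V => s(q.1.2, q.2)) h)

/-- `N` is a family of nets: its points `(i, x)` at level `i` are `4 ^ i`-separated endpoints of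
demands in `l` of length at least `4 ^ i`, and `P` assigns to some of them a parent in the net one
level up. -/
structure IsNet (l : List (X × X)) (N : Finset (ℤ × X)) (P : Finset ((ℤ × X) × X)) : Prop where
  demand : ∀ i x, (i, x) ∈ N → ∃ p ∈ l, (x = p.1 ∨ x = p.2) ∧ (4 : ℝ) ^ i ≤ dist p.1 p.2
  sep : ∀ i x y, (i, x) ∈ N → (i, y) ∈ N → x ≠ y → (4 : ℝ) ^ i ≤ dist x y
  parent : ∀ i x y, ((i, x), y) ∈ P →
    (i, x) ∈ N ∧ (i + 1, y) ∈ N ∧ dist x y ≤ 6 * (4 : ℝ) ^ i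
  unique : ∀ q y y', (q, y) ∈ P → (q, y') ∈ P → y = y'

namespace IsNet

variable {l : List (X × X)} {N : Finset (ℤ × X)} {P : Finset ((ℤ × X) × X)}

theorem mono {l' : List (X × X)} (h : IsNet l N P) (hl : l ⊆ l') : IsNet l' N P where
  demand i x hx := (h.demand i x hx).imp fun _ hp => ⟨hl hp.1, hp.2⟩
  sep := h.sep
  parent := h.parent
  unique := h.unique

theorem injOn_fst (h : IsNet l N P) : Set.InjOn (Prod.fst : (ℤ × X) × X → ℤ × X) P := by
  rintro ⟨q, y⟩ hq ⟨q', y'⟩ hq' heq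
  obtain rfl : q = q' := heq
  rw [h.unique q y y' hq hq']

theorem card_parents_le (h : IsNet l N P) : P.card ≤ N.card :=
  Finset.card_le_card_of_injOn Prod.fst (fun q hq => (h.parent q.1.1 q.1.2 q.2 hq).1) h.injOn_fst

theorem sum_parents_le (h : IsNet l N P) (φ : ℤ → ℝ) (hφ : ∀ i, 0 ≤ φ i) :
    ∑ q ∈ P, φ q.1.1 ≤ ∑ q ∈ N, φ q.1 := by
  rw [← Finset.sum_image (f := fun q : ℤ × X => φ q.1) h.injOn_fst]
  refine Finset.sum_le_sum_of_subset_of_nonneg ?_ fun q _ _ => hφ _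
  intro q hq
  obtain ⟨q', hq', rfl⟩ := Finset.mem_image.1 hq
  exact (h.parent q'.1.1 q'.1.2 q'.2 hq').1

theorem insert_center (h : IsNet l N P) {j : ℤ} {s : X}
    (hs : ∃ p ∈ l, (s = p.1 ∨ s = p.2) ∧ (4 : ℝ) ^ j ≤ dist p.1 p.2)
    (hfar : ∀ x, (j, x) ∈ N → (4 : ℝ) ^ j ≤ dist s x) : IsNet l (insert (j, s) N) P where
  demand i x hx := by
    rcases Finset.mem_insert.1 hx with hx | hx
    · obtain ⟨rfl, rfl⟩ := Prod.mk.inj hx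
      exact hs
    · exact h.demand i x hx
  sep i x y hx hy hxy := by
    rcases Finset.mem_insert.1 hx with hx | hx <;> rcases Finset.mem_insert.1 hy with hy | hy
    · exact absurd ((Prod.mk.inj hx).2.trans (Prod.mk.inj hy).2.symm) hxy
    · rw [(Prod.mk.inj hx).1] at hy ⊢
      rw [(Prod.mk.inj hx).2]
      exact hfar y hy
    · rw [(Prod.mk.inj hy).1] at hx ⊢
      rw [(Prod.mk.inj hy).2, dist_comm]
      exact hfar x hx
    · exact h.sep i x y hx hy hxy
  parent i x y hxy :=
    have h' := h.parent i x y hxy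
    ⟨Finset.mem_insert_of_mem h'.1, Finset.mem_insert_of_mem h'.2.1, h'.2.2⟩
  unique := h.unique

theorem insert_parent (h : IsNet l N P) {i : ℤ} {x y : X} (hx : (i, x) ∈ N)
    (hy : (i + 1, y) ∈ N) (hxy : dist x y ≤ 6 * (4 : ℝ) ^ i) (hnew : ∀ z, ((i, x), z) ∉ P) :
    IsNet l N (insert ((i, x), y) P) where
  demand := h.demand
  sep := h.sep
  parent i' x' y' h' := by
    rcases Finset.mem_insert.1 h' with h' | h'
    · simp only [Prod.mk.injEq] at h'
      obtain ⟨⟨rfl, rfl⟩, rfl⟩ := h'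
      exact ⟨hx, hy, hxy⟩
    · exact h.parent i' x' y' h'
  unique q z z' hz hw := by
    rcases Finset.mem_insert.1 hz with hz | hz <;> rcases Finset.mem_insert.1 hw with hw | hw
    · exact (Prod.mk.inj hz).2.trans (Prod.mk.inj hw).2.symm
    · rw [(Prod.mk.inj hz).1] at hw
      exact absurd hw (hnew z')
    · rw [(Prod.mk.inj hw).1] at hz
      exact absurd hz (hnew z)
    · exact h.unique q z z' hz hw

/-- Every net point near a point of the next net level can be given a parent. -/
theorem exists_parent (h : IsNet l N P) {i : ℤ} {x y : X} (hx : (i, x) ∈ N)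
    (hy : (i + 1, y) ∈ N) (hxy : dist x y ≤ 6 * (4 : ℝ) ^ i) :
    ∃ P', P ⊆ P' ∧ IsNet l N P' ∧ ∃ z, ((i, x), z) ∈ P' := by
  by_cases hex : ∃ z, ((i, x), z) ∈ P
  · exact ⟨P, subset_rfl, h, hex⟩
  · push Not at hex
    exact ⟨_, Finset.subset_insert _ _, h.insert_parent hx hy hxy hex, y,
      Finset.mem_insert_self _ _⟩

end IsNet

theorem edgeLen_nonneg (e : Sym2 X) : 0 ≤ edgeLen e := by
  induction e with
  | _ a b => exact dist_nonneg

@[simp]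
theorem edgeLen_mk (a b : X) : edgeLen s(a, b) = dist a b := rfl

theorem Linked.dist_le {E : Set (Sym2 X)} {L : ℝ} {a b : X} (h : Linked E edgeLen L a b) :
    dist a b ≤ L := by
  induction h with
  | refl a h => simpa using h
  | @step L L' a b c he _ hL ih =>
    rw [edgeLen_mk] at hL
    linarith [dist_triangle a b c]

/-- By inserting at most one net point and some parent pointers, a terminal is linked to a net
point of any level that is admissible for it. -/
theorem IsNet.exists_attach {l : List (X × X)} {N : Finset (ℤ × X)} {P : Finset ((ℤ × X) × X)}
    (h : IsNet l N P) {s : X} (j : ℤ)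
    (hs : ∃ p ∈ l, (s = p.1 ∨ s = p.2) ∧ (4 : ℝ) ^ j ≤ dist p.1 p.2) :
    ∃ N' P' c, N ⊆ N' ∧ P ⊆ P' ∧ IsNet l N' P' ∧ N'.card ≤ N.card + 1 ∧ (j, c) ∈ N' ∧
      Linked (parentEdges P' : Set (Sym2 X)) edgeLen (2 * (4 : ℝ) ^ j) s c := by
  obtain ⟨n, hn⟩ : ∃ n : ℕ, ∀ q ∈ N, j < q.1 + n := by
    obtain ⟨B, hB⟩ := (N.image fun q => j - q.1).bddAbove
    refine ⟨(B + 1).toNat, fun q hq => ?_⟩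
    have : j - q.1 ≤ B := hB (Finset.mem_coe.2 (Finset.mem_image_of_mem _ hq))
    have := Int.self_le_toNat (B + 1)
    omega
  induction n generalizing j with
  | zero =>
    refine ⟨insert (j, s) N, P, s, Finset.subset_insert _ _, subset_rfl,
      h.insert_center hs fun x hx => absurd (hn _ hx) (by simp), Finset.card_insert_le _ _,
      Finset.mem_insert_self _ _, .refl _ (by positivity)⟩
  | succ n ih =>
    by_cases hfar : ∀ x, (j, x) ∈ N → (4 : ℝ) ^ j ≤ dist s x
    · exact ⟨insert (j, s) N, P, s, Finset.subset_insert _ _, subset_rfl,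
        h.insert_center hs hfar, Finset.card_insert_le _ _,
        Finset.mem_insert_self _ _, .refl _ (by positivity)⟩
    push Not at hfar
    obtain ⟨y, hy, hsy⟩ := hfar
    have hpow : (4 : ℝ) ^ j = 4 * (4 : ℝ) ^ (j - 1) := by
      rw [← zpow_one_add₀ (by norm_num)]
      congr 1
      ring
    have hpos : (0 : ℝ) < 4 ^ (j - 1) := by positivity
    obtain ⟨N', P', c, hN, hP, hnet, hcard, hc, hlink⟩ := ih (j - 1)
      (hs.imp fun p hp => ⟨hp.1, hp.2.1, by linarith [hp.2.2]⟩)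
      fun q hq => by have := hn q hq; push_cast at this; omega
    have hcy : dist c y ≤ 6 * (4 : ℝ) ^ (j - 1) := by
      have := hlink.dist_le
      have := dist_triangle_left c y s
      linarith
    obtain ⟨P'', hP'', hnet', z, hz⟩ := hnet.exists_parent hc
      (by rw [sub_add_cancel]; exact hN hy) hcy
    obtain ⟨-, hzN, hcz⟩ := hnet'.parent _ _ _ hz
    rw [sub_add_cancel] at hzN
    refine ⟨N', P'', z, hN, hP.trans hP'', hnet', hcard, hzN, ?_⟩
    have hlink' := hlink.mono_set (Finset.coe_subset.2 (parentEdges_mono hP''))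
    refine (hlink'.trans (.single (mem_parentEdges hz))).mono_len ?_
    rw [edgeLen_mk]
    linarith

end Net

section SteinerForest

variable {F : Finset (Sym2 X)}

theorem reachable_of_isWalkIn {V : Type*} {F : Set (Sym2 V)} {a b : V} {p : List V}
    (h : IsWalkIn F a b p) : (SimpleGraph.fromEdgeSet F).Reachable a b := by
  induction p generalizing a with
  | nil => simp [IsWalkIn] at h
  | cons x p ih =>
    obtain ⟨h₁, h₂, h₃⟩ := h
    obtain rfl : x = a := by simpa using h₁
    cases p with
    | nil =>
      obtain rfl : x = b := by simpa using h₂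
      rfl
    | cons y p =>
      have hyb := ih (a := y) ⟨rfl, by simpa using h₂, fun e he => h₃ e (by
        simp only [edgeList, List.tail_cons] at he ⊢
        simp [he])⟩
      by_cases hxy : x = y
      · exact hxy ▸ hyb
      · have hadj : (SimpleGraph.fromEdgeSet F).Adj x y := by
          rw [SimpleGraph.fromEdgeSet_adj]
          exact ⟨h₃ _ (by simp [edgeList]), hxy⟩
        exact hadj.reachable.trans hyb

/-- The variation of a function along an unordered pair. -/
def edgeVar {V : Type*} (f : V → ℝ) (e : Sym2 V) : ℝ :=
  Sym2.lift ⟨fun x y => |f x - f y|, fun x y => abs_sub_comm (f x) (f y)⟩ e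

@[simp]
theorem edgeVar_mk {V : Type*} (f : V → ℝ) (a b : V) : edgeVar f s(a, b) = |f a - f b| := rfl

theorem edgeVar_nonneg {V : Type*} (f : V → ℝ) (e : Sym2 V) : 0 ≤ edgeVar f e := by
  induction e with
  | _ a b => exact abs_nonneg _

theorem abs_sub_le_sum_edges {V : Type*} {G : SimpleGraph V} (f : V → ℝ) {a b : V}
    (p : G.Walk a b) : |f a - f b| ≤ (p.edges.map (edgeVar f)).sum := by
  induction p with
  | nil => simp
  | @cons u v w _ _ ih =>
    simp only [SimpleGraph.Walk.edges_cons, List.map_cons, List.sum_cons, edgeVar_mk]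
    linarith [abs_sub_le (f u) (f v) (f w)]

/-- A function varies between connected points by at most its total variation. -/
theorem abs_sub_le_sum_edgeVar {a b : X} (f : X → ℝ)
    (h : graphDist (F : Set (Sym2 X)) a b ≠ ⊤) : |f a - f b| ≤ ∑ e ∈ F, edgeVar f e := by
  obtain ⟨p, hp⟩ : ∃ p, IsWalkIn (F : Set (Sym2 X)) a b p := by
    by_contra! hcon
    have : IsEmpty { p : List X // IsWalkIn (F : Set (Sym2 X)) a b p } :=
      ⟨fun p => hcon p.1 p.2⟩
    exact h (iInf_of_empty _)
  obtain ⟨w⟩ := reachable_of_isWalkIn hp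
  have hw := w.toPath.2.isTrail.edges_nodup
  refine (abs_sub_le_sum_edges f w.toPath.1).trans ?_
  rw [← List.sum_toFinset _ hw]
  refine Finset.sum_le_sum_of_subset_of_nonneg (fun e he => ?_) fun e _ _ => edgeVar_nonneg f e
  have := w.toPath.1.edges_subset_edgeSet (List.mem_toFinset.1 he)
  rw [SimpleGraph.edgeSet_fromEdgeSet] at this
  exact this.1

/-- The truncated distance to `x` varies along an edge only if an endpoint is within the
truncation radius. -/
theorem edgeVar_min_dist_le (x a b : X) (ρ : ℝ) :
    |min (dist x a) ρ - min (dist x b) ρ| ≤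
      (if dist x a < ρ then dist a b else 0) + (if dist x b < ρ then dist a b else 0) := by
  have hab : |dist x a - dist x b| ≤ dist a b := by
    rw [dist_comm x a, dist_comm x b]
    exact abs_dist_sub_le a b x
  have h0 : 0 ≤ dist a b := dist_nonneg
  have hmin : |min (dist x a) ρ - min (dist x b) ρ| ≤ dist a b :=
    (abs_min_sub_min_le_max _ _ _ _).trans (by simp [hab])
  split_ifs with h₁ h₂ h₂
  · linarith
  · linarith
  · linarith
  · rw [min_eq_right (not_lt.1 h₁), min_eq_right (not_lt.1 h₂)]
    simp

theorem sum_ite_dist_lt_le {S : Finset X} {ρ c : ℝ} (hc : 0 ≤ c)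
    (hsep : ∀ x ∈ S, ∀ y ∈ S, x ≠ y → 2 * ρ ≤ dist x y) (a : X) :
    ∑ x ∈ S, (if dist x a < ρ then c else 0) ≤ c := by
  rw [← Finset.sum_filter, Finset.sum_const, nsmul_eq_mul]
  have : (S.filter fun x => dist x a < ρ).card ≤ 1 := by
    refine Finset.card_le_one.2 fun x hx y hy => ?_
    by_contra hne
    rw [Finset.mem_filter] at hx hy
    have := hsep x hx.1 y hy.1 hne
    linarith [dist_triangle_right x y a, hx.2, hy.2]
  have : ((S.filter fun x => dist x a < ρ).card : ℝ) ≤ 1 := by exact_mod_cast this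
  nlinarith

/-- Disjoint balls that must each be left by the forest bound its cost from below. -/
theorem card_mul_le_graphCost {S : Finset X} {ρ : ℝ}
    (hsep : ∀ x ∈ S, ∀ y ∈ S, x ≠ y → 2 * ρ ≤ dist x y)
    (hF : ∀ x ∈ S, ∃ p : X × X, (x = p.1 ∨ x = p.2) ∧ ρ ≤ dist p.1 p.2 ∧
      graphDist (F : Set (Sym2 X)) p.1 p.2 ≠ ⊤) :
    S.card * ρ ≤ 2 * graphCost F := by
  have h₁ : ∀ x ∈ S, ρ ≤ ∑ e ∈ F, edgeVar (fun z => min (dist x z) ρ) e := by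
    intro x hx
    obtain ⟨⟨y, z⟩, hyz, hρ, hconn⟩ := hF x hx
    refine le_trans ?_ (abs_sub_le_sum_edgeVar (fun z => min (dist x z) ρ) hconn)
    rcases hyz with rfl | rfl
    · rw [abs_sub_comm]
      refine le_trans ?_ (le_abs_self _)
      simp only [dist_self, min_eq_right hρ]
      linarith [min_le_left 0 ρ]
    · rw [dist_comm] at hρ
      refine le_trans ?_ (le_abs_self _)
      simp only [dist_self, min_eq_right hρ]
      linarith [min_le_left 0 ρ]
  calc S.card * ρ = ∑ x ∈ S, ρ := by simp
    _ ≤ ∑ x ∈ S, ∑ e ∈ F, edgeVar (fun z => min (dist x z) ρ) e := Finset.sum_le_sum h₁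
    _ = ∑ e ∈ F, ∑ x ∈ S, edgeVar (fun z => min (dist x z) ρ) e := Finset.sum_comm
    _ ≤ ∑ e ∈ F, 2 * edgeLen e := by
      refine Finset.sum_le_sum fun e _ => ?_
      induction e with
      | _ a b =>
        simp only [edgeVar_mk, edgeLen_mk]
        refine (Finset.sum_le_sum fun x _ => edgeVar_min_dist_le x a b ρ).trans ?_
        rw [Finset.sum_add_distrib]
        linarith [sum_ite_dist_lt_le (dist_nonneg (x := a) (y := b)) hsep a,
          sum_ite_dist_lt_le (dist_nonneg (x := a) (y := b)) hsep b]
    _ = 2 * graphCost F := by rw [graphCost, Finset.mul_sum]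

end SteinerForest

section Fiber

variable {ι V : Type*} [DecidableEq ι]

/-- The elements indexed by `i` in a finite indexed family. -/
def fiber (N : Finset (ι × V)) (i : ι) : Finset V :=
  (N.filter fun q => q.1 = i).image Prod.snd

@[simp]
theorem mem_fiber {N : Finset (ι × V)} {i : ι} {x : V} : x ∈ fiber N i ↔ (i, x) ∈ N := by
  simp [fiber]

theorem card_fiber (N : Finset (ι × V)) (i : ι) :
    (fiber N i).card = (N.filter fun q => q.1 = i).card := by
  refine Finset.card_image_of_injOn fun q hq q' hq' h => ?_
  exact Prod.ext ((Finset.mem_filter.1 hq).2.trans (Finset.mem_filter.1 hq').2.symm) h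

theorem fiber_mono {N N' : Finset (ι × V)} (h : N ⊆ N') (i : ι) : fiber N i ⊆ fiber N' i :=
  fun _ hx => mem_fiber.2 (h (mem_fiber.1 hx))

theorem sum_eq_sum_card_fiber (N : Finset (ι × V)) (φ : ι → ℝ) :
    ∑ q ∈ N, φ q.1 = ∑ i ∈ N.image Prod.fst, (fiber N i).card * φ i := by
  rw [Finset.sum_comp φ Prod.fst]
  simp [card_fiber]

end Fiber

theorem graphCost_nonneg (F : Finset (Sym2 X)) : 0 ≤ graphCost F :=
  Finset.sum_nonneg fun e _ => edgeLen_nonneg e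

namespace IsNet

variable {l : List (X × X)} {N : Finset (ℤ × X)} {P : Finset ((ℤ × X) × X)}
  {F : Finset (Sym2 X)}

theorem card_fiber_mul_le (h : IsNet l N P)
    (hF : ∀ p ∈ l, graphDist (F : Set (Sym2 X)) p.1 p.2 ≠ ⊤) (i : ℤ) :
    (fiber N i).card * (4 : ℝ) ^ i ≤ 4 * graphCost F := by
  have hpos : (0 : ℝ) < 4 ^ i := by positivity
  have := card_mul_le_graphCost (F := F) (S := fiber N i) (ρ := 4 ^ i / 2)
    (fun x hx y hy hxy => by
      linarith [h.sep i x y (mem_fiber.1 hx) (mem_fiber.1 hy) hxy])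
    fun x hx => by
      obtain ⟨p, hp, hxp, hdist⟩ := h.demand i x (mem_fiber.1 hx)
      exact ⟨p, hxp, by linarith, hF p hp⟩
  linarith

/-- Only logarithmically many net levels matter for the total scale of the net points. -/
theorem sum_zpow_le (h : IsNet l N P)
    (hF : ∀ p ∈ l, graphDist (F : Set (Sym2 X)) p.1 p.2 ≠ ⊤) {k : ℕ} (hk : 1 ≤ k)
    (hcard : N.card ≤ 2 * k) :
    ∑ q ∈ N, (4 : ℝ) ^ q.1 ≤ 12 * (1 + Nat.log 2 k) * graphCost F := by
  have hcost := graphCost_nonneg F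
  rcases N.eq_empty_or_nonempty with rfl | hne
  · simp only [Finset.sum_empty]
    positivity
  obtain ⟨⟨i₀, x₀⟩, hx₀, hmax⟩ := N.exists_max_image Prod.fst hne
  have htop : (4 : ℝ) ^ i₀ ≤ 4 * graphCost F := by
    have h₁ : (1 : ℝ) ≤ (fiber N i₀).card := by
      exact_mod_cast Finset.card_pos.2 ⟨x₀, mem_fiber.2 hx₀⟩
    have h₂ : (0 : ℝ) < 4 ^ i₀ := by positivity
    have h₃ := h.card_fiber_mul_le hF i₀
    nlinarith
  have hk' : (0 : ℝ) < k := by exact_mod_cast hk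
  set L := Nat.log 2 k with hL
  rw [← Finset.sum_filter_add_sum_filter_not N fun q : ℤ × X => i₀ - L ≤ q.1]
  have hlarge : ∑ q ∈ N.filter (fun q => i₀ - L ≤ q.1), (4 : ℝ) ^ q.1
      ≤ (L + 1) * (4 * graphCost F) := by
    rw [← Finset.sum_fiberwise_of_maps_to (t := Finset.Icc (i₀ - L) i₀) (g := Prod.fst)
      fun q hq => Finset.mem_Icc.2
        ⟨(Finset.mem_filter.1 hq).2, hmax q (Finset.mem_filter.1 hq).1⟩]
    have hterm : ∀ i ∈ Finset.Icc (i₀ - L) i₀,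
        ∑ q ∈ (N.filter fun q => i₀ - L ≤ q.1).filter (fun q => q.1 = i), (4 : ℝ) ^ q.1
          ≤ 4 * graphCost F := by
      intro i _
      refine le_trans ?_ (h.card_fiber_mul_le hF i)
      rw [Finset.sum_congr rfl (g := fun _ => (4 : ℝ) ^ i)
        fun q hq => by rw [(Finset.mem_filter.1 hq).2], Finset.sum_const, nsmul_eq_mul,
        card_fiber]
      gcongr
      exact Finset.filter_subset _ _
    refine (Finset.sum_le_card_nsmul _ _ _ hterm).trans (le_of_eq ?_)
    have hIcc : i₀ + 1 - (i₀ - (L : ℤ)) = ((L + 1 : ℕ) : ℤ) := by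
      push_cast
      ring
    rw [Int.card_Icc, hIcc, Int.toNat_natCast, nsmul_eq_mul]
    push_cast
    ring
  have hsmall : ∑ q ∈ N.filter (fun q => ¬ i₀ - L ≤ q.1), (4 : ℝ) ^ q.1
      ≤ 2 * (4 * graphCost F) := by
    have hterm : ∀ q ∈ N.filter (fun q => ¬ i₀ - L ≤ q.1),
        (4 : ℝ) ^ q.1 ≤ 4 ^ i₀ / k := by
      intro q hq
      have hq' := (Finset.mem_filter.1 hq).2
      rw [le_div_iff₀ hk']
      have h₁ : (k : ℝ) ≤ 4 ^ (L + 1) := by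
        have h₂ : k < 2 ^ (L + 1) := Nat.lt_pow_succ_log_self (by norm_num) k
        have h₃ : (2 : ℕ) ^ (L + 1) ≤ 4 ^ (L + 1) := Nat.pow_le_pow_left (by norm_num) _
        exact_mod_cast (h₂.trans_le h₃).le
      calc (4 : ℝ) ^ q.1 * k ≤ 4 ^ q.1 * 4 ^ (L + 1) := by gcongr
        _ = (4 : ℝ) ^ (q.1 + (L + 1 : ℕ)) := by
          rw [zpow_add₀ (by norm_num), zpow_natCast]
        _ ≤ 4 ^ i₀ := zpow_le_zpow_right₀ (by norm_num) (by push_cast; omega)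
    refine (Finset.sum_le_card_nsmul _ _ _ hterm).trans ?_
    rw [nsmul_eq_mul]
    have hc : ((N.filter fun q => ¬ i₀ - L ≤ q.1).card : ℝ) ≤ 2 * k := by
      exact_mod_cast (Finset.card_filter_le _ _).trans hcard
    calc ((N.filter fun q => ¬ i₀ - L ≤ q.1).card : ℝ) * (4 ^ i₀ / k)
        ≤ 2 * k * (4 ^ i₀ / k) := by gcongr
      _ = 2 * 4 ^ i₀ := by field_simp
      _ ≤ 2 * (4 * graphCost F) := by gcongr
  have : (0 : ℝ) ≤ L * graphCost F := by positivity
  linarith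

end IsNet

section Linkage

/-- `G` is a family of graphs on the nets `N`: the graph indexed by `(i, m)` has short edges between
net points at level `i`, large girth, and was built while the net had about `2 ^ m` points. -/
structure IsLinkage (N : Finset (ℤ × X)) (G : Finset ((ℤ × ℕ) × Sym2 X)) : Prop where
  endpoint : ∀ i m a b, ((i, m), s(a, b)) ∈ G →
    (i, a) ∈ N ∧ (i, b) ∈ N ∧ dist a b ≤ 8 * (4 : ℝ) ^ i
  girth : ∀ i m, LargeGirth (fiber G (i, m) : Set (Sym2 X)) (2 * ((m + 1 : ℕ) : ℝ))
  count : ∀ i m, (fiber G (i, m)).card ≤ 4 * 2 ^ m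
  phase : ∀ i m e, ((i, m), e) ∈ G → 2 ^ m ≤ (fiber N i).card

namespace IsLinkage

variable {N : Finset (ℤ × X)} {G : Finset ((ℤ × ℕ) × Sym2 X)}

theorem mono {N' : Finset (ℤ × X)} (h : IsLinkage N G) (hN : N ⊆ N') : IsLinkage N' G where
  endpoint i m a b hab :=
    have h' := h.endpoint i m a b hab
    ⟨hN h'.1, hN h'.2.1, h'.2.2⟩
  girth := h.girth
  count := h.count
  phase i m e he := (h.phase i m e he).trans (Finset.card_le_card (fiber_mono hN i))

theorem edgeLen_le (h : IsLinkage N G) {g : (ℤ × ℕ) × Sym2 X} (hg : g ∈ G) :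
    edgeLen g.2 ≤ 8 * (4 : ℝ) ^ g.1.1 := by
  obtain ⟨⟨i, m⟩, e⟩ := g
  induction e with
  | _ a b => exact (h.endpoint i m a b hg).2.2

theorem card_level_le (h : IsLinkage N G) (i : ℤ) :
    (G.filter fun g => g.1.1 = i).card ≤ 8 * (fiber N i).card := by
  rcases (G.filter fun g => g.1.1 = i).eq_empty_or_nonempty with hG | ⟨g₀, hg₀⟩
  · simp [hG]
  have hphase : ∀ g ∈ G.filter (fun g => g.1.1 = i), 2 ^ g.1.2 ≤ (fiber N i).card := by
    intro g hg
    obtain ⟨hgG, rfl⟩ := Finset.mem_filter.1 hg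
    exact h.phase g.1.1 g.1.2 g.2 hgG
  set n := (fiber N i).card
  have hn : n ≠ 0 := by
    have := (Nat.two_pow_pos _).trans_le (hphase g₀ hg₀)
    omega
  have hsub : (G.filter fun g => g.1.1 = i) ⊆
      (Finset.range (Nat.log 2 n + 1)).biUnion fun m => G.filter fun g => g.1 = (i, m) := by
    intro g hg
    have hm := Nat.le_log_of_pow_le (by norm_num) (hphase g hg)
    obtain ⟨hgG, rfl⟩ := Finset.mem_filter.1 hg
    exact Finset.mem_biUnion.2 ⟨g.1.2, Finset.mem_range.2 (by omega),
      Finset.mem_filter.2 ⟨hgG, rfl⟩⟩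
  have hgeom : ∑ m ∈ Finset.range (Nat.log 2 n + 1), 4 * 2 ^ m ≤ 8 * n := by
    have h₁ := Nat.pow_log_le_self 2 hn
    rw [← Finset.mul_sum, Nat.geomSum_eq (by norm_num), pow_succ]
    omega
  refine (Finset.card_le_card hsub).trans (Finset.card_biUnion_le.trans (le_trans ?_ hgeom))
  refine Finset.sum_le_sum fun m _ => ?_
  rw [← card_fiber]
  exact h.count i m

theorem sum_le (h : IsLinkage N G) (φ : ℤ → ℝ) (hφ : ∀ i, 0 ≤ φ i) :
    ∑ g ∈ G, φ g.1.1 ≤ 8 * ∑ q ∈ N, φ q.1 := by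
  rw [Finset.sum_comp φ fun g : (ℤ × ℕ) × Sym2 X => g.1.1, sum_eq_sum_card_fiber,
    Finset.mul_sum]
  have hsub : (G.image fun g => g.1.1) ⊆ N.image Prod.fst := by
    intro i hi
    obtain ⟨⟨⟨i, m⟩, e⟩, hg, rfl⟩ := Finset.mem_image.1 hi
    induction e with
    | _ a b => exact Finset.mem_image.2 ⟨_, (h.endpoint i m a b hg).1, rfl⟩
  refine le_trans (Finset.sum_le_sum fun i _ => ?_)
    (Finset.sum_le_sum_of_subset_of_nonneg hsub fun i _ _ =>
      mul_nonneg (by norm_num) (mul_nonneg (Nat.cast_nonneg _) (hφ i)))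
  rw [nsmul_eq_mul, ← mul_assoc]
  refine mul_le_mul_of_nonneg_right ?_ (hφ i)
  exact_mod_cast h.card_level_le i

theorem insert (h : IsLinkage N G) {j : ℤ} {c c' : X} (hc : (j, c) ∈ N) (hc' : (j, c') ∈ N)
    (hcc' : dist c c' ≤ 8 * (4 : ℝ) ^ j)
    (hfar : ¬ Linked (fiber G (j, Nat.log 2 (fiber N j).card) : Set (Sym2 X)) (hopWeight X)
      (2 * ((Nat.log 2 (fiber N j).card + 1 : ℕ) : ℝ)) c c') :
    IsLinkage N (insert ((j, Nat.log 2 (fiber N j).card), s(c, c')) G) := by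
  set m₀ := Nat.log 2 (fiber N j).card with hm₀
  set G' := Insert.insert ((j, m₀), s(c, c')) G with hG'
  have hsame : fiber G' (j, m₀) = Insert.insert s(c, c') (fiber G (j, m₀)) := by
    ext e
    simp [hG']
  have hother : ∀ i m, (i, m) ≠ (j, m₀) → fiber G' (i, m) = fiber G (i, m) := by
    intro i m hne
    ext e
    simp only [hG', mem_fiber, Finset.mem_insert, Prod.mk.injEq]
    simp only [ne_eq, Prod.mk.injEq] at hne
    tauto
  have hpos : (fiber N j).card ≠ 0 := (Finset.card_pos.2 ⟨c, mem_fiber.2 hc⟩).ne'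
  have hend : ∀ i m a b, ((i, m), s(a, b)) ∈ G' →
      (i, a) ∈ N ∧ (i, b) ∈ N ∧ dist a b ≤ 8 * (4 : ℝ) ^ i := by
    intro i m a b hab
    rcases Finset.mem_insert.1 hab with hab | hab
    · simp only [Prod.mk.injEq] at hab
      obtain ⟨⟨rfl, rfl⟩, heq⟩ := hab
      rcases Sym2.eq_iff.1 heq with ⟨rfl, rfl⟩ | ⟨rfl, rfl⟩
      · exact ⟨hc, hc', hcc'⟩
      · exact ⟨hc', hc, by rwa [dist_comm]⟩
    · exact h.endpoint i m a b hab
  have hgirth : LargeGirth (fiber G' (j, m₀) : Set (Sym2 X)) (2 * ((m₀ + 1 : ℕ) : ℝ)) := by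
    rw [hsame, Finset.coe_insert]
    exact (h.girth j m₀).insert hfar
  refine ⟨hend, fun i m => ?_, fun i m => ?_, fun i m e he => ?_⟩
  · by_cases hne : (i, m) = (j, m₀)
    · obtain ⟨rfl, rfl⟩ := Prod.mk.inj hne
      exact hgirth
    · rw [hother i m hne]
      exact h.girth i m
  · by_cases hne : (i, m) = (j, m₀)
    · rw [hne, (Prod.mk.inj hne).2]
      have hlt : (fiber N j).card < 2 ^ (m₀ + 1) :=
        Nat.lt_pow_succ_log_self (by norm_num) _
      have hle := hgirth.card_le hlt fun e he x hx => by
        obtain ⟨y, rfl⟩ := hx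
        exact mem_fiber.2 (hend j m₀ x y (mem_fiber.1 he)).1
      rw [pow_succ] at hlt
      omega
    · rw [hother i m hne]
      exact h.count i m
  · rcases Finset.mem_insert.1 he with he | he
    · simp only [Prod.mk.injEq] at he
      obtain ⟨⟨rfl, rfl⟩, -⟩ := he
      exact Nat.pow_log_le_self 2 hpos
    · exact h.phase i m e he

/-- Nearby net points can be linked by a walk of logarithmically many hops. -/
theorem exists_link (h : IsLinkage N G) {j : ℤ} {c c' : X} (hc : (j, c) ∈ N) (hc' : (j, c') ∈ N)
    (hcc' : dist c c' ≤ 8 * (4 : ℝ) ^ j) :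
    ∃ G', G ⊆ G' ∧ IsLinkage N G' ∧
      Linked (G'.image Prod.snd : Set (Sym2 X)) edgeLen
        (8 * (4 : ℝ) ^ j * (2 * ((Nat.log 2 (fiber N j).card + 1 : ℕ) : ℝ))) c c' := by
  by_cases hnear : Linked (fiber G (j, Nat.log 2 (fiber N j).card) : Set (Sym2 X)) (hopWeight X)
      (2 * ((Nat.log 2 (fiber N j).card + 1 : ℕ) : ℝ)) c c'
  · refine ⟨G, subset_rfl, h, (hnear.of_weight_le (M := 8 * (4 : ℝ) ^ j) (by positivity)
      fun e he => ?_).mono_set fun e he => ?_⟩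
    · simpa [hopWeight] using h.edgeLen_le (mem_fiber.1 he)
    · exact Finset.mem_coe.2 (Finset.mem_image_of_mem _ (mem_fiber.1 he))
  · refine ⟨_, Finset.subset_insert _ _, h.insert hc hc' hcc' hnear,
      (Linked.single (Finset.mem_coe.2
        (Finset.mem_image_of_mem Prod.snd (Finset.mem_insert_self _ _)))).mono_len ?_⟩
    have hpos : (0 : ℝ) < 4 ^ j := by positivity
    have hm : (0 : ℝ) ≤ Nat.log 2 (fiber N j).card := Nat.cast_nonneg _
    rw [edgeLen_mk]
    push_cast
    nlinarith

end IsLinkage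

end Linkage

section Spanner

theorem graphCost_image_le {ι : Type*} (T : Finset ι) (f : ι → Sym2 X) :
    graphCost (T.image f) ≤ ∑ q ∈ T, edgeLen (f q) :=
  Finset.sum_image_le_of_nonneg fun _ _ => edgeLen_nonneg _

/-- The state of the online algorithm: net points, their parents, and links between net points. -/
structure SpannerState (V : Type*) where
  centers : Finset (ℤ × V)
  parents : Finset ((ℤ × V) × V)
  links : Finset ((ℤ × ℕ) × Sym2 V)

/-- The edges bought in a given state. -/
def SpannerState.edges {V : Type*} (S : SpannerState V) : Finset (Sym2 V) :=
  parentEdges S.parents ∪ S.links.image Prod.snd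

theorem SpannerState.edges_subset {V : Type*} {S S' : SpannerState V}
    (hP : S.parents ⊆ S'.parents) (hG : S.links ⊆ S'.links) : S.edges ⊆ S'.edges :=
  Finset.union_subset_union (parentEdges_mono hP) (Finset.image_subset_image hG)

/-- The stretch guaranteed after `k` demands. -/
def stretchBound (k : ℕ) : ℝ := 36 * (1 + Real.logb 2 k)

theorem logb_two_natCast_nonneg (k : ℕ) : 0 ≤ Real.logb 2 k :=
  (Nat.cast_nonneg _).trans (by exact_mod_cast Real.natLog_le_logb k 2)

theorem stretchBound_mono {k k' : ℕ} (hk : 0 < k) (h : k ≤ k') :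
    stretchBound k ≤ stretchBound k' := by
  have : Real.logb 2 k ≤ Real.logb 2 k' :=
    Real.logb_le_logb_of_le (by norm_num) (by exact_mod_cast hk) (by exact_mod_cast h)
  unfold stretchBound
  linarith

/-- The invariant of the online algorithm after the demands in `l`. -/
structure SpannerState.Valid (l : List (X × X)) (S : SpannerState X) : Prop where
  net : IsNet l S.centers S.parents
  linkage : IsLinkage S.centers S.links
  card_le : S.centers.card ≤ 2 * l.length
  stretch : ∀ p ∈ l, Linked (S.edges : Set (Sym2 X)) edgeLen
    (stretchBound l.length * dist p.1 p.2) p.1 p.2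

namespace SpannerState.Valid

variable {l : List (X × X)} {S : SpannerState X}

theorem nil : Valid [] (⟨∅, ∅, ∅⟩ : SpannerState X) where
  net := by constructor <;> simp
  linkage := by
    constructor
    · simp
    · intro i m a b hab
      simp [fiber] at hab
    · simp [fiber]
    · simp
  card_le := by simp
  stretch := by simp

theorem stretch_cons (h : Valid l S) {S' : SpannerState X} (hS : S.edges ⊆ S'.edges)
    (p q : X × X) (hq : q ∈ l) :
    Linked (S'.edges : Set (Sym2 X)) edgeLen
      (stretchBound (p :: l).length * dist q.1 q.2) q.1 q.2 := by
  refine ((h.stretch q hq).mono_set (Finset.coe_subset.2 hS)).mono_len ?_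
  exact mul_le_mul_of_nonneg_right
    (stretchBound_mono (List.length_pos_of_mem hq) (by simp)) dist_nonneg

theorem exists_cons (h : Valid l S) (p : X × X) :
    ∃ S', S.edges ⊆ S'.edges ∧ Valid (p :: l) S' := by
  obtain ⟨s, t⟩ := p
  have hsub : l ⊆ (s, t) :: l := List.subset_cons_self _ _
  by_cases hst : s = t
  · subst hst
    refine ⟨S, subset_rfl, h.net.mono hsub, h.linkage, h.card_le.trans (by simp), ?_⟩
    intro q hq
    rcases List.mem_cons.1 hq with rfl | hq
    · exact .refl _ (by simp)
    · exact h.stretch_cons subset_rfl _ q hq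
  obtain ⟨j, hj, hj'⟩ := exists_mem_Ico_zpow (dist_pos.2 hst) (show (1 : ℝ) < 4 by norm_num)
  rw [zpow_add_one₀ (by norm_num)] at hj'
  have hpos : (0 : ℝ) < 4 ^ j := by positivity
  obtain ⟨N₁, P₁, c, hN₁, hP₁, hnet₁, hcard₁, hc, hsc⟩ := (h.net.mono hsub).exists_attach
    (s := s) j ⟨(s, t), List.mem_cons_self, .inl rfl, hj⟩
  obtain ⟨N₂, P₂, c', hN₂, hP₂, hnet₂, hcard₂, hc', htc'⟩ := hnet₁.exists_attach
    (s := t) j ⟨(s, t), List.mem_cons_self, .inr rfl, hj⟩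
  have hcc' : dist c c' ≤ 8 * (4 : ℝ) ^ j := by
    have h₁ := hsc.dist_le
    have h₂ := htc'.dist_le
    have h₃ := dist_triangle4 c s t c'
    rw [dist_comm c s] at h₃
    linarith
  obtain ⟨G, hG, hlinkage, hlink⟩ := (h.linkage.mono (hN₁.trans hN₂)).exists_link
    (hN₂ hc) hc' hcc'
  have hedges : S.edges ⊆ (⟨N₂, P₂, G⟩ : SpannerState X).edges :=
    edges_subset (hP₁.trans hP₂) hG
  have hcard : N₂.card ≤ 2 * ((s, t) :: l).length := by
    have := h.card_le
    rw [List.length_cons]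
    omega
  refine ⟨⟨N₂, P₂, G⟩, hedges, hnet₂, hlinkage, hcard, fun q hq => ?_⟩
  rcases List.mem_cons.1 hq with rfl | hq
  · have hpar : (parentEdges P₂ : Set (Sym2 X)) ⊆ (⟨N₂, P₂, G⟩ : SpannerState X).edges :=
      Finset.coe_subset.2 Finset.subset_union_left
    have hlnk : (G.image Prod.snd : Set (Sym2 X)) ⊆ (⟨N₂, P₂, G⟩ : SpannerState X).edges :=
      Finset.coe_subset.2 Finset.subset_union_right
    have h₁ := (hsc.mono_set (Finset.coe_subset.2 (parentEdges_mono hP₂))).mono_set hpar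
    refine ((h₁.trans (hlink.mono_set hlnk)).trans (htc'.symm.mono_set hpar)).mono_len ?_
    set K := ((s, t) :: l).length with hK
    have hKpos : K ≠ 0 := by simp [hK]
    have hlog : Nat.log 2 (fiber N₂ j).card ≤ Nat.log 2 K + 1 := by
      rw [← Nat.log_mul_base (by norm_num) hKpos]
      refine Nat.log_mono_right ?_
      rw [card_fiber]
      have := Finset.card_filter_le N₂ fun q => q.1 = j
      omega
    have hlog' : (Nat.log 2 (fiber N₂ j).card : ℝ) ≤ Real.logb 2 K + 1 := by
      have h₂ : (Nat.log 2 K : ℝ) ≤ Real.logb 2 K := by exact_mod_cast Real.natLog_le_logb K 2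
      have h₃ : (Nat.log 2 (fiber N₂ j).card : ℝ) ≤ Nat.log 2 K + 1 := by exact_mod_cast hlog
      linarith
    have hnn := logb_two_natCast_nonneg K
    unfold stretchBound
    push_cast
    calc 2 * (4 : ℝ) ^ j + 8 * 4 ^ j * (2 * (Nat.log 2 (fiber N₂ j).card + 1)) + 2 * 4 ^ j
        = (4 + 16 * (Nat.log 2 (fiber N₂ j).card + 1)) * (4 : ℝ) ^ j := by ring
      _ ≤ (36 * (1 + Real.logb 2 K)) * dist s t :=
        mul_le_mul (by linarith) hj hpos.le (by positivity)
  · exact h.stretch_cons hedges _ q hq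

theorem card_edges_le (h : Valid l S) : (S.edges.card : ℝ) ≤ 18 * l.length := by
  have h₁ := h.net.card_parents_le
  have h₂ := h.linkage.sum_le (fun _ => 1) fun _ => zero_le_one
  simp only [Finset.sum_const, nsmul_eq_mul, mul_one] at h₂
  have h₃ : S.links.card ≤ 8 * S.centers.card := by exact_mod_cast h₂
  have h₄ := h.card_le
  have h₅ : S.edges.card ≤ S.parents.card + S.links.card :=
    (Finset.card_union_le _ _).trans (add_le_add Finset.card_image_le Finset.card_image_le)
  exact_mod_cast (show S.edges.card ≤ 18 * l.length by omega)

theorem graphCost_edges_le (h : Valid l S) (hl : l ≠ []) {F : Finset (Sym2 X)}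
    (hF : ∀ p ∈ l, graphDist (F : Set (Sym2 X)) p.1 p.2 ≠ ⊤) :
    graphCost S.edges ≤ 840 * (1 + Real.logb 2 l.length) * graphCost F := by
  have hP : graphCost (parentEdges S.parents) ≤ 6 * ∑ q ∈ S.centers, (4 : ℝ) ^ q.1 := by
    rw [Finset.mul_sum]
    refine le_trans ?_ (h.net.sum_parents_le (fun i => 6 * (4 : ℝ) ^ i)
      fun i => by positivity)
    exact (graphCost_image_le _ _).trans (Finset.sum_le_sum fun q hq =>
      (h.net.parent q.1.1 q.1.2 q.2 hq).2.2)
  have hG : graphCost (S.links.image Prod.snd) ≤ 64 * ∑ q ∈ S.centers, (4 : ℝ) ^ q.1 := by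
    have h₁ := h.linkage.sum_le (fun i => 8 * (4 : ℝ) ^ i) fun i => by positivity
    rw [← Finset.mul_sum] at h₁
    have h₂ := (graphCost_image_le S.links Prod.snd).trans
      (Finset.sum_le_sum fun g hg => h.linkage.edgeLen_le hg)
    rw [← Finset.mul_sum] at h₁ h₂
    linarith
  have hunion : graphCost S.edges ≤
      graphCost (parentEdges S.parents) + graphCost (S.links.image Prod.snd) := by
    have := Finset.sum_union_inter (s₁ := parentEdges S.parents)
      (s₂ := S.links.image Prod.snd) (f := edgeLen)
    have := graphCost_nonneg (parentEdges S.parents ∩ S.links.image Prod.snd)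
    unfold SpannerState.edges graphCost at *
    linarith
  have hsum := h.net.sum_zpow_le hF (List.length_pos_iff.2 hl) h.card_le
  have hlog : (Nat.log 2 l.length : ℝ) ≤ Real.logb 2 l.length := by
    exact_mod_cast Real.natLog_le_logb l.length 2
  have := mul_le_mul_of_nonneg_right hlog (graphCost_nonneg F)
  linarith

end SpannerState.Valid

/-- A run of the online algorithm on a list of demands, the most recent one coming first. -/
def spannerRun : (l : List (X × X)) → { S : SpannerState X // S.Valid l }
  | [] => ⟨_, .nil⟩
  | p :: l => ⟨_, ((spannerRun l).2.exists_cons p).choose_spec.2⟩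

/-- The edges bought by the online algorithm on a sequence of demands. -/
def onlineSpanner (l : List (X × X)) : Finset (Sym2 X) := (spannerRun l.reverse).1.edges

theorem onlineSpanner_mono (l l' : List (X × X)) :
    onlineSpanner l ⊆ onlineSpanner (l ++ l') := by
  rw [onlineSpanner, onlineSpanner, List.reverse_append]
  induction l'.reverse with
  | nil => exact subset_rfl
  | cons p l'' ih =>
    exact ih.trans ((spannerRun (l'' ++ l.reverse)).2.exists_cons p).choose_spec.1

theorem Linked.exists_isWalkIn {H : Set (Sym2 X)} {L : ℝ} {a b : X}
    (h : Linked H edgeLen L a b) : ∃ p, IsWalkIn H a b p ∧ pathLen p ≤ L := by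
  induction h with
  | refl a h => exact ⟨[a], by simp [IsWalkIn, edgeList], by simpa [pathLen, edgeList] using h⟩
  | @step L L' a c b he _ hL ih =>
    obtain ⟨p, ⟨h₁, h₂, h₃⟩, hlen⟩ := ih
    cases p with
    | nil => simp at h₁
    | cons x p =>
      obtain rfl : x = c := by simpa using h₁
      refine ⟨a :: x :: p, ⟨rfl, by simpa using h₂, fun e he' => ?_⟩, ?_⟩
      · have : e = s(a, x) ∨ e ∈ edgeList (x :: p) := by simpa [edgeList] using he'
        rcases this with rfl | he'
        · exact he
        · exact h₃ e he'
      · have : pathLen (a :: x :: p) = edgeLen s(a, x) + pathLen (x :: p) := by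
          simp [pathLen, edgeList]
        linarith

theorem Linked.graphDist_le {H : Set (Sym2 X)} {L : ℝ} {a b : X}
    (h : Linked H edgeLen L a b) : graphDist H a b ≤ ENNReal.ofReal L := by
  obtain ⟨p, hp, hlen⟩ := h.exists_isWalkIn
  exact (iInf_le _ (⟨p, hp⟩ : { p : List X // IsWalkIn H a b p })).trans
    (ENNReal.ofReal_le_ofReal hlen)

end Spanner

/-- **Theorem 5 (Online multi-commodity spanner).**
There is a universal constant `C` such that for every metric space `X` there is
an online algorithm, maintaining a monotonically growing set of edges as terminal
pairs arrive, such that after any sequence of `k ≥ 1` pairs `(s_i, t_i)`: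
(i) every pair is stretched by at most `C·(1 + log₂ k)`;
(ii) the cost is at most `C·(1 + log₂ k)` times the optimal Steiner forest
connecting the pairs; and (iii) the number of edges is at most `C·k`. -/
theorem online_multicommodity_spanner :
    ∃ C : ℝ, 0 < C ∧
      ∀ (X : Type) [MetricSpace X],
        ∃ A : List (X × X) → Finset (Sym2 X),
          -- online: the edge set only grows as pairs arrive
          (∀ l l' : List (X × X), A l ⊆ A (l ++ l')) ∧
          ∀ (k : ℕ), 1 ≤ k → ∀ p : Fin k → X × X,
            -- (i) stretch C·(1 + log₂ k) between each given pair
            (∀ i : Fin k,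
              graphDist (↑(A (List.ofFn p))) (p i).1 (p i).2
                ≤ ENNReal.ofReal (C * (1 + Real.logb 2 (k : ℝ)) * dist (p i).1 (p i).2)) ∧
            -- (ii) cost at most C·(1 + log₂ k) times the optimal Steiner forest
            (graphCost (A (List.ofFn p))
              ≤ C * (1 + Real.logb 2 (k : ℝ)) *
                  sInf { c | ∃ F : Finset (Sym2 X),
                    (∀ i : Fin k, graphDist (↑F) (p i).1 (p i).2 ≠ ⊤) ∧
                    c = graphCost F }) ∧
            -- (iii) linearly many edges
            ((A (List.ofFn p)).card : ℝ) ≤ C * (k : ℝ) := by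

  refine ⟨840, by norm_num, fun X _ => ⟨onlineSpanner, onlineSpanner_mono, fun k hk p => ?_⟩⟩
  have hvalid := (spannerRun (List.ofFn p).reverse).2
  have hlen : (List.ofFn p).reverse.length = k := by simp
  have hlog := logb_two_natCast_nonneg k
  refine ⟨fun i => ?_, ?_, ?_⟩
  · have := (hvalid.stretch (p i) (by simp)).graphDist_le
    rw [hlen] at this
    refine this.trans (ENNReal.ofReal_le_ofReal (mul_le_mul_of_nonneg_right ?_ dist_nonneg))
    unfold stretchBound
    linarith
  · have hpos : 0 < 840 * (1 + Real.logb 2 (k : ℝ)) := by positivity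
    rw [← div_le_iff₀' hpos]
    refine le_csInf ⟨_, Finset.univ.image fun i => s((p i).1, (p i).2), fun i => ?_, rfl⟩ ?_
    · refine ((Linked.single ?_).graphDist_le.trans_lt ENNReal.ofReal_lt_top).ne
      exact Finset.mem_coe.2 (Finset.mem_image_of_mem (fun i => s((p i).1, (p i).2))
        (Finset.mem_univ i))
    · rintro c ⟨F, hF, rfl⟩
      rw [div_le_iff₀' hpos]
      have := hvalid.graphCost_edges_le (F := F)
        (by rw [← List.length_pos_iff, hlen]; exact hk) (by simpa using hF)
      rwa [hlen] at this
  · have := hvalid.card_edges_le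
    rw [hlen] at this
    refine this.trans ?_
    have : (0 : ℝ) ≤ k := Nat.cast_nonneg k
    linarith
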